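/- Let M = Γ(K,v) be an (H,u)-perfect pseudo MV-algebra with (H,u)-decomposition (M_t : t ∈ [0,u]_H). Then M_0 is a prime ideal of M: if x ∧ y ∈ M_0, then x ∈ M_0 or y ∈ M_0. -/

import Mathlib

open Pointwise

/-- `v` is a strong (order) unit of an ordered group: `v ≥ 0` and every element is
dominated by some positive multiple of `v`. -/
def IsStrongOrderUnit {G : Type*} [AddMonoid G] [PartialOrder G] (v : G) : Prop :=
  0 ≤ v ∧ ∀ g : G, ∃ n : ℕ, 0 < n ∧ g ≤ n • v

section Decomposition

variable {H : Type*} [AddGroup H] [LinearOrder H]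
  [CovariantClass H H (· + ·) (· ≤ ·)]
  [CovariantClass H H (Function.swap (· + ·)) (· ≤ ·)]
variable {K : Type*} [AddGroup K] [Lattice K]
  [CovariantClass K K (· + ·) (· ≤ ·)]
  [CovariantClass K K (Function.swap (· + ·)) (· ≤ ·)]

/-- An `(H,u)`-decomposition of the pseudo MV-algebra `M = Γ(K,v)`:
a family `(Mt t : t ∈ [0,u]_H)` of nonempty, pairwise disjoint subsets of `[0,v]`
covering `[0,v]` such that (a) `Mt s ≤ Mt t` for `s < t`;
(b) `(Mt t)⁻ = Mt (u - t)` and `(Mt t)∼ = Mt (-t + u)` (here `x⁻ = v - x`, `x∼ = -x + v`);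
(c) `x ⊕ y = (x + y) ⊓ v ∈ Mt (min (s+t) u)` whenever `x ∈ Mt s`, `y ∈ Mt t`. -/
structure IsHuDecomposition (u : H) (v : K) (Mt : H → Set K) : Prop where
  nonempty : ∀ t ∈ Set.Icc (0 : H) u, (Mt t).Nonempty
  subset_carrier : ∀ t ∈ Set.Icc (0 : H) u, Mt t ⊆ Set.Icc (0 : K) v
  pairwise_disjoint : ∀ s ∈ Set.Icc (0 : H) u, ∀ t ∈ Set.Icc (0 : H) u,
    s ≠ t → Disjoint (Mt s) (Mt t)
  cover : ∀ x ∈ Set.Icc (0 : K) v, ∃ t ∈ Set.Icc (0 : H) u, x ∈ Mt t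
  le_of_lt : ∀ s ∈ Set.Icc (0 : H) u, ∀ t ∈ Set.Icc (0 : H) u, s < t →
    ∀ a ∈ Mt s, ∀ b ∈ Mt t, a ≤ b
  compl_image : ∀ t ∈ Set.Icc (0 : H) u, (fun x => v - x) '' Mt t = Mt (u - t)
  sim_image : ∀ t ∈ Set.Icc (0 : H) u, (fun x => -x + v) '' Mt t = Mt (-t + u)
  oplus_mem : ∀ s ∈ Set.Icc (0 : H) u, ∀ t ∈ Set.Icc (0 : H) u,
    ∀ x ∈ Mt s, ∀ y ∈ Mt t, (x + y) ⊓ v ∈ Mt (min (s + t) u)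

set_option linter.unusedSectionVars false in
/-- A point of the carrier lies in only one piece of the decomposition. -/
theorem IsHuDecomposition.eq_of_mem {u : H} {v : K} {Mt : H → Set K}
    (hdec : IsHuDecomposition u v Mt) {s t : H} (hs : s ∈ Set.Icc (0 : H) u)
    (ht : t ∈ Set.Icc (0 : H) u) {x : K} (hxs : x ∈ Mt s) (hxt : x ∈ Mt t) : s = t := by
  by_contra hne
  exact Set.disjoint_left.mp (hdec.pairwise_disjoint s hs t ht hne) hxs hxt

set_option linter.unusedSectionVars false in
/-- Cancelling a summand from `Mt 0` does not change the piece. -/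
theorem IsHuDecomposition.mem_of_add_mem {u : H} {v : K} {Mt : H → Set K}
    (hdec : IsHuDecomposition u v Mt) (hu : 0 < u) {t : H} (ht : t ∈ Set.Icc (0 : H) u)
    {a z : K} (ha : 0 ≤ a) (hz : z ∈ Mt 0) (haz : a + z ∈ Mt t) : a ∈ Mt t := by
  have h0 : (0 : H) ∈ Set.Icc (0 : H) u := ⟨le_rfl, hu.le⟩
  have hazv := (hdec.subset_carrier t ht haz).2
  have hav : a ≤ v :=
    (le_add_of_nonneg_right (hdec.subset_carrier 0 h0 hz).1).trans hazv
  obtain ⟨p, hp, hap⟩ := hdec.cover a ⟨ha, hav⟩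
  have h := hdec.oplus_mem p hp 0 h0 a hap z hz
  rw [add_zero, min_eq_left hp.2, inf_eq_left.mpr hazv] at h
  exact hdec.eq_of_mem hp ht h haz ▸ hap

theorem IsHuDecomposition.zero_mem {u : H} {v : K} {Mt : H → Set K}
    (hdec : IsHuDecomposition u v Mt) (hu : 0 < u) : (0 : K) ∈ Mt 0 := by
  have h0 : (0 : H) ∈ Set.Icc (0 : H) u := ⟨le_rfl, hu.le⟩
  obtain ⟨z, hz⟩ := hdec.nonempty 0 h0
  exact hdec.mem_of_add_mem hu h0 le_rfl hz (by rwa [zero_add])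

/-- Two orthogonal elements never share a piece `Mt t` with `0 < t`. -/
theorem IsHuDecomposition.not_mem_of_orthogonal {u : H} {v : K} {Mt : H → Set K}
    (hdec : IsHuDecomposition u v Mt) {t : H} (ht0 : 0 < t) (htu : t ≤ u)
    {a b : K} (hab : a ⊓ b ≤ 0) (ha : a ∈ Mt t) : b ∉ Mt t := by
  intro hb
  have hu : 0 < u := ht0.trans_le htu
  have h0 : (0 : H) ∈ Set.Icc (0 : H) u := ⟨le_rfl, hu.le⟩
  have ht : t ∈ Set.Icc (0 : H) u := ⟨ht0.le, htu⟩
  have ha0 := (hdec.subset_carrier t ht ha).1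
  have hbv := hdec.subset_carrier t ht hb
  have key : b ≤ a → False := fun hba => by
    have hb0 : b = 0 := le_antisymm ((le_inf hba le_rfl).trans hab) hbv.1
    exact ht0.ne (hdec.eq_of_mem h0 ht (hdec.zero_mem hu) (hb0 ▸ hb))
  rcases htu.eq_or_lt with rfl | hlt
  · have hc : v - a ∈ Mt 0 := by
      rw [← sub_self t, ← hdec.compl_image t ht]
      exact ⟨a, ha, rfl⟩
    have hle : v - a ≤ 0 :=
      (le_inf (hdec.le_of_lt 0 h0 t ht ht0 _ hc _ ha)
        (hdec.le_of_lt 0 h0 t ht ht0 _ hc _ hb)).trans hab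
    exact key (hbv.2.trans (sub_nonpos.mp hle))
  · have hlt' : t < min (t + t) u := by
      refine lt_min (lt_of_le_of_ne (le_add_of_nonneg_left ht0.le) fun h => ?_) hlt
      exact ht0.ne' (left_eq_add.mp h)
    have hle : b ≤ a + a :=
      (hdec.le_of_lt t ht _ ⟨ht0.le.trans hlt'.le, min_le_right _ _⟩ hlt' b hb _
        (hdec.oplus_mem t ht t ht a ha a ha)).trans inf_le_left
    have h1 : -a + b ≤ a := neg_add_le_iff_le_add.mpr hle
    have h2 : -a + b ≤ b := neg_add_le_iff_le_add.mpr (le_add_of_nonneg_left ha0)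
    exact key (by simpa using neg_add_le_iff_le_add.mp ((le_inf h1 h2).trans hab))

/-- In an `(H,u)`-perfect pseudo MV-algebra `M = Γ(K,v)` with
`(H,u)`-decomposition `(Mt t)`, the ideal `Mt 0` is prime: if `x ⊓ y ∈ Mt 0`
for `x, y ∈ M`, then `x ∈ Mt 0` or `y ∈ Mt 0`. -/
theorem statement_8 (u : H) (v : K) (hu : 0 < u)
    (hsuH : IsStrongOrderUnit u) (hsuK : IsStrongOrderUnit v)
    (Mt : H → Set K) (hdec : IsHuDecomposition u v Mt)
    (x y : K) (hx : x ∈ Set.Icc (0 : K) v) (hy : y ∈ Set.Icc (0 : K) v)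
    (hxy : x ⊓ y ∈ Mt 0) :
    x ∈ Mt 0 ∨ y ∈ Mt 0 := by
  obtain ⟨s, hs, hxs⟩ := hdec.cover x hx
  obtain ⟨t, ht, hyt⟩ := hdec.cover y hy
  rcases lt_trichotomy s t with hst | rfl | hst
  · left
    rwa [inf_eq_left.mpr (hdec.le_of_lt s hs t ht hst x hxs y hyt)] at hxy
  · rcases hs.1.eq_or_lt with rfl | hs0
    · exact Or.inl hxs
    have hx' : x - x ⊓ y ∈ Mt s :=
      hdec.mem_of_add_mem hu hs (sub_nonneg.mpr inf_le_left) hxy (by rwa [sub_add_cancel])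
    have hy' : y - x ⊓ y ∈ Mt s :=
      hdec.mem_of_add_mem hu hs (sub_nonneg.mpr inf_le_right) hxy (by rwa [sub_add_cancel])
    refine absurd hy' (hdec.not_mem_of_orthogonal hs0 hs.2 ?_ hx')
    rw [← add_le_iff_nonpos_left (b := x ⊓ y)]
    exact le_inf (le_sub_iff_add_le.mp inf_le_left) (le_sub_iff_add_le.mp inf_le_right)
  · right
    rwa [inf_eq_right.mpr (hdec.le_of_lt t ht s hs hst y hyt x hxs)] at hxy
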